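/- arXiv:2405.19911 — 2 statements merged into one kernel-verified Lean document; each statement's English description precedes it below -/
import Mathlib

section
/- Let n be even, let λ ∈ F_{q^n} \ F_{q^2}, let t = [F_{q^2}(λ):F_{q^2}], let l ≥ 1, and let S = ⟨1, λ, …, λ^{l−1}⟩_{F_{q^2}} ⊕ λ^l·F_q. Then C = Orb(S) is a full weight spectrum code in G_q(n, 2l+1) with m(C) = 2t if and only if 2l+1 ≤ t. Moreover, in that case ω_2(C) = q. -/
/-!
Setting: `q` is a prime power, realized by a finite field `Fq` with `Fintype.card Fq = q`;
`F` plays the role of `F_{q^n}`: a finite field extension of `Fq` with `Module.finrank Fq F = n`.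
`F_q`-subspaces of `F_{q^n}` are `Submodule Fq F`; for a divisor `t` of `n`, the subfield
`F_{q^t}` is the (unique) `T : IntermediateField Fq F` with `Module.finrank Fq ↥T = t`, and
`F_{q^t}`-subspaces are `Submodule ↥T F`.
-/

set_option synthInstance.maxHeartbeats 1000000

namespace FWS

variable (R : Type*) {F : Type*} [Field R] [Field F] [Algebra R F]

/-- The cyclic shift `α S = {α * s : s ∈ S}` of an `R`-subspace `S` of `F`. -/
def shift (α : F) (S : Submodule R F) : Submodule R F :=
  S.map (LinearMap.mulLeft R α)

/-- The subspace distance `d(U,V) = dim U + dim V - 2 dim (U ⊓ V)`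
(which is `2k - 2 dim (U ⊓ V)` for `U, V` of the same dimension `k`). -/
noncomputable def sdist (U V : Submodule R F) : ℕ :=
  Module.finrank R ↥U + Module.finrank R ↥V - 2 * Module.finrank R ↥(U ⊓ V)

/-- The one-orbit cyclic subspace code `Orb(S) = {α S : α ∈ F*}`. -/
def orb (S : Submodule R F) : Set (Submodule R F) :=
  {T | ∃ α : F, α ≠ 0 ∧ T = shift R α S}

/-- The weight `ω_{2i}(Orb(S)) = #{α S : α ∈ F*, d(S, α S) = 2 i}`. -/
noncomputable def omega (S : Submodule R F) (i : ℕ) : ℕ :=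
  Nat.card {T : Submodule R F // T ∈ orb R S ∧ sdist R S T = 2 * i}

/-- `Orb(S)` is a full weight spectrum (FWS) code: `ω_{2i} > 0` for all `1 ≤ i ≤ dim S`. -/
def IsFWS (S : Submodule R F) : Prop :=
  ∀ i : ℕ, 1 ≤ i → i ≤ Module.finrank R ↥S → 0 < omega R S i

/-- The subspace `⟨1, l, ..., l^(k-1)⟩_R` spanned by the first `k` powers of `l`. -/
def polySpan (l : F) (k : ℕ) : Submodule R F :=
  Submodule.span R ((fun i : ℕ => l ^ i) '' Set.Iio k)

/-- The invariant `m(Orb(S))`: the least divisor `t` of `n` such that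
`dim_{F_{q^t}} ⟨S⟩_{F_{q^t}} = 1` (equivalently, the degree of the smallest subfield
containing a cyclic shift of `S`). -/
noncomputable def mOrb (S : Submodule R F) : ℕ :=
  sInf {t : ℕ | t ∣ Module.finrank R F ∧
    ∃ T : IntermediateField R F, Module.finrank R ↥T = t ∧
      Module.finrank ↥T ↥(Submodule.span ↥T (S : Set F)) = 1}

/-- The stabilizer `H(S) = {x ∈ F* : x S = S} ∪ {0}` of a set `S ⊆ F`, as a subset of `F`
(it is a subfield of `F` when `S` is a subspace). -/
def stab {F : Type*} [Field F] (S : Set F) : Set F :=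
  {x : F | x ≠ 0 ∧ (fun y => x * y) '' S = S} ∪ {0}

end FWS



namespace FWS

open Polynomial

section General

variable {k K F : Type*} [Field k] [Field K] [Field F] [Algebra k K] [Algebra K F] [Algebra k F]
  [IsScalarTower k K F]

lemma finrank_map_of_injOn {V W : Type*} [AddCommGroup V] [Module k V] [AddCommGroup W]
    [Module k W] (φ : V →ₗ[k] W) (p : Submodule k V) (h : ∀ x ∈ p, φ x = 0 → x = 0) :
    Module.finrank k (p.map φ) = Module.finrank k p := by
  rw [← LinearMap.range_domRestrict]
  refine LinearMap.finrank_range_of_inj ?_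
  rw [← LinearMap.ker_eq_bot, LinearMap.ker_eq_bot']
  rintro ⟨x, hx⟩ h0
  exact Subtype.ext (h x hx h0)

lemma mem_shift {α x : F} {S : Submodule k F} : x ∈ shift k α S ↔ ∃ s ∈ S, α * s = x :=
  Iff.rfl

lemma finrank_shift {α : F} (hα : α ≠ 0) (S : Submodule k F) :
    Module.finrank k (shift k α S) = Module.finrank k S :=
  finrank_map_of_injOn _ _ fun _ _ hx => (mul_eq_zero.mp hx).resolve_left hα

lemma shift_mul (α β : F) (S : Submodule k F) :
    shift k (α * β) S = shift k α (shift k β S) := by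
  rw [shift, shift, shift, ← Submodule.map_comp, LinearMap.mulLeft_mul]

lemma shift_injective {α : F} (hα : α ≠ 0) :
    Function.Injective (shift k α : Submodule k F → Submodule k F) :=
  Submodule.map_injective_of_injective fun _ _ h => mul_left_cancel₀ hα h

lemma shift_algebraMap {c : k} (hc : c ≠ 0) (S : Submodule k F) :
    shift k (algebraMap k F c) S = S := by
  ext x
  rw [mem_shift]
  constructor
  · rintro ⟨s, hs, rfl⟩
    rw [← Algebra.smul_def]
    exact S.smul_mem c hs
  · intro hx
    refine ⟨c⁻¹ • x, S.smul_mem _ hx, ?_⟩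
    rw [← Algebra.smul_def, smul_inv_smul₀ hc]

lemma omega_pos [Finite F] {S : Submodule k F} {α : F} (hα : α ≠ 0) {i : ℕ}
    (h : Module.finrank k ↥(S ⊓ shift k α S) + i = Module.finrank k S) : 0 < omega k S i := by
  have : Finite (Submodule k F) := Finite.of_injective _ SetLike.coe_injective
  have hne : Nonempty {T : Submodule k F // T ∈ orb k S ∧ sdist k S T = 2 * i} := by
    refine ⟨⟨shift k α S, ⟨α, hα, rfl⟩, ?_⟩⟩
    rw [sdist, finrank_shift hα]
    omega
  exact Nat.card_pos

/-- The polynomials of degree at most `j` whose coefficient of degree `j` lies in `D`. -/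
noncomputable def boundedPoly (j : ℕ) (D : Submodule k K) : Submodule k K[X] :=
  (degreeLT K (j + 1)).restrictScalars k ⊓ D.comap ((lcoeff K j).restrictScalars k)

lemma mem_boundedPoly {j : ℕ} {D : Submodule k K} {p : K[X]} :
    p ∈ boundedPoly j D ↔ p.natDegree ≤ j ∧ p.coeff j ∈ D := by
  rw [boundedPoly, Submodule.mem_inf, Submodule.restrictScalars_mem, mem_degreeLT,
    degree_lt_iff_coeff_zero, natDegree_le_iff_coeff_eq_zero]
  rfl

lemma boundedPoly_eq_sup (j : ℕ) (D : Submodule k K) :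
    boundedPoly j D = (degreeLT K j).restrictScalars k ⊔
      D.map ((monomial j : K →ₗ[K] K[X]).restrictScalars k) := by
  apply le_antisymm
  · intro p hp
    rw [mem_boundedPoly] at hp
    rw [← sub_add_cancel p (monomial j (p.coeff j))]
    refine Submodule.add_mem_sup ?_ ⟨_, hp.2, rfl⟩
    rw [Submodule.restrictScalars_mem, mem_degreeLT, degree_lt_iff_coeff_zero]
    intro m hm
    rw [coeff_sub, coeff_monomial]
    split_ifs with h
    · rw [h, sub_self]
    · rw [sub_zero, coeff_eq_zero_of_natDegree_lt (by omega)]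
  · refine sup_le ?_ ?_
    · intro p hp
      rw [Submodule.restrictScalars_mem, mem_degreeLT, degree_lt_iff_coeff_zero] at hp
      rw [mem_boundedPoly, natDegree_le_iff_coeff_eq_zero, hp j le_rfl]
      exact ⟨fun N hN => hp N hN.le, D.zero_mem⟩
    · rintro _ ⟨d, hd, rfl⟩
      rw [mem_boundedPoly]
      exact ⟨natDegree_monomial_le d, by simpa using hd⟩

lemma finrank_boundedPoly [FiniteDimensional k K] (j : ℕ) (D : Submodule k K) :
    Module.finrank k (boundedPoly j D) = j * Module.finrank k K + Module.finrank k D := by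
  have e := (degreeLTEquiv K j).restrictScalars k
  have h1 : Module.finrank k ((degreeLT K j).restrictScalars k) = j * Module.finrank k K := by
    refine e.finrank_eq.trans ?_
    rw [Module.finrank_pi_fintype]
    simp
  have : FiniteDimensional k ((degreeLT K j).restrictScalars k) := Module.Finite.equiv e.symm
  have h2 : Module.finrank k (D.map ((monomial j : K →ₗ[K] K[X]).restrictScalars k)) =
      Module.finrank k D :=
    finrank_map_of_injOn _ _ fun x _ hx => (monomial_eq_zero_iff x j).mp hx
  have h3 : (degreeLT K j).restrictScalars k ⊓
      D.map ((monomial j : K →ₗ[K] K[X]).restrictScalars k) = ⊥ := by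
    rw [eq_bot_iff]
    rintro _ ⟨hp, ⟨d, -, rfl⟩⟩
    rw [SetLike.mem_coe, Submodule.restrictScalars_mem, mem_degreeLT,
      degree_lt_iff_coeff_zero] at hp
    have := hp j le_rfl
    simp only [LinearMap.coe_restrictScalars, coeff_monomial_same] at this
    simp [this]
  have h4 := Submodule.finrank_sup_add_finrank_inf_eq ((degreeLT K j).restrictScalars k)
      (D.map ((monomial j : K →ₗ[K] K[X]).restrictScalars k))
  rw [h3, finrank_bot, ← boundedPoly_eq_sup] at h4
  omega

/-- Evaluation of polynomials at `lam`, as a `k`-linear map. -/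
noncomputable def evalAt (k : Type*) {K F : Type*} [Field k] [Field K] [Field F] [Algebra k K]
    [Algebra K F] [Algebra k F] [IsScalarTower k K F] (lam : F) : K[X] →ₗ[k] F :=
  ((aeval lam).toLinearMap : K[X] →ₗ[K] F).restrictScalars k

lemma evalAt_apply (lam : F) (p : K[X]) : evalAt k lam p = aeval lam p := rfl

lemma polySpan_sup_eq_map (lam : F) (l : ℕ) :
    (polySpan K lam l).restrictScalars k ⊔ Submodule.span k {lam ^ l} =
      (boundedPoly l (Submodule.span k {(1 : K)})).map (evalAt k lam) := by
  classical
  rw [boundedPoly_eq_sup, Submodule.map_sup]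
  congr 1
  · have h : polySpan K lam l = (degreeLT K l).map (aeval lam).toLinearMap := by
      rw [polySpan, degreeLT_eq_span_X_pow, Submodule.map_span]
      congr 1
      ext x
      simp
    rw [h]
    rfl
  · rw [Submodule.map_span, Submodule.map_span]
    simp [evalAt_apply]

/-- `lam` is not a root of a nonzero polynomial over `K` of degree less than `t`. -/
def NoSmallRoot (K : Type*) {F : Type*} [Field K] [Field F] [Algebra K F] (lam : F) (t : ℕ) :
    Prop :=
  ∀ p : K[X], p.natDegree < t → aeval lam p = 0 → p = 0

lemma shift_inf_eq_map {lam : F} {t l m : ℕ} (hlam : NoSmallRoot K lam t) (hl : 2 * l < t)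
    (hm : m ≤ l) {f g : K[X]} (hf : f.natDegree ≤ m) (hg : g.natDegree ≤ m) (hf0 : f ≠ 0)
    (hmax : f.coeff m ≠ 0 ∨ g.coeff m ≠ 0) (hco : IsCoprime f g)
    (D : Submodule k K) {α : F} (hα : α * aeval lam g = aeval lam f) :
    (boundedPoly l D).map (evalAt k lam) ⊓ shift k α ((boundedPoly l D).map (evalAt k lam)) =
      (boundedPoly (l - m) (D.comap (LinearMap.mulLeft k (f.coeff m)) ⊓
        D.comap (LinearMap.mulLeft k (g.coeff m)))).map
          (evalAt k lam ∘ₗ LinearMap.mulLeft k f) := by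
  apply le_antisymm
  · rintro _ ⟨⟨p, hp, rfl⟩, ⟨_, ⟨r, hr, rfl⟩, hx⟩⟩
    rw [SetLike.mem_coe, mem_boundedPoly] at hp hr
    simp only [evalAt_apply, LinearMap.mulLeft_apply] at hx
    have hpr : p * g = f * r := by
      rw [← sub_eq_zero]
      apply hlam
      · refine (natDegree_sub_le_of_le (m := l + m) (n := l + m) ?_ ?_).trans_lt (by omega)
        · exact natDegree_mul_le_of_le hp.1 hg
        · rw [mul_comm]
          exact natDegree_mul_le_of_le hr.1 hf
      · rw [map_sub, map_mul, map_mul, ← hx, ← hα]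
        ring
    obtain ⟨h, rfl⟩ : f ∣ p := hco.dvd_of_dvd_mul_right ⟨r, hpr⟩
    have hrg : r = g * h := by
      apply mul_left_cancel₀ hf0
      rw [← hpr]
      ring
    subst hrg
    have hdeg : h.natDegree ≤ l - m := by
      by_cases hh : h = 0
      · simp [hh]
      rcases hmax with hc | hc
      · have h1 := le_natDegree_of_ne_zero hc
        have h2 := hp.1
        rw [natDegree_mul hf0 hh] at h2
        omega
      · have h1 := le_natDegree_of_ne_zero hc
        have hg0 : g ≠ 0 := by
          rintro rfl
          simp at hc
        have h2 := hr.1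
        rw [natDegree_mul hg0 hh] at h2
        omega
    refine ⟨h, ?_, rfl⟩
    rw [SetLike.mem_coe, mem_boundedPoly]
    have e : l = m + (l - m) := by omega
    refine ⟨hdeg, ?_, ?_⟩
    · have := hp.2
      rw [e, coeff_mul_add_eq_of_natDegree_le hf hdeg] at this
      exact this
    · have := hr.2
      rw [e, coeff_mul_add_eq_of_natDegree_le hg hdeg] at this
      exact this
  · rintro _ ⟨h, hh, rfl⟩
    rw [SetLike.mem_coe, mem_boundedPoly] at hh
    obtain ⟨hdeg, hcf, hcg⟩ := hh
    have e : m + (l - m) = l := by omega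
    refine ⟨⟨f * h, ?_, rfl⟩, ⟨_, ⟨g * h, ?_, rfl⟩, ?_⟩⟩
    · rw [SetLike.mem_coe, mem_boundedPoly]
      refine ⟨(natDegree_mul_le_of_le hf hdeg).trans e.le, ?_⟩
      have := coeff_mul_add_eq_of_natDegree_le hf hdeg
      rw [e] at this
      rw [this]
      exact hcf
    · rw [SetLike.mem_coe, mem_boundedPoly]
      refine ⟨(natDegree_mul_le_of_le hg hdeg).trans e.le, ?_⟩
      have := coeff_mul_add_eq_of_natDegree_le hg hdeg
      rw [e] at this
      rw [this]
      exact hcg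
    · simp only [evalAt_apply, LinearMap.mulLeft_apply, LinearMap.comp_apply, map_mul]
      rw [← hα]
      ring

lemma finrank_shift_inf [FiniteDimensional k K] {lam : F} {t l m : ℕ}
    (hlam : NoSmallRoot K lam t) (hl : 2 * l < t)
    (hm : m ≤ l) {f g : K[X]} (hf : f.natDegree ≤ m) (hg : g.natDegree ≤ m) (hf0 : f ≠ 0)
    (hmax : f.coeff m ≠ 0 ∨ g.coeff m ≠ 0) (hco : IsCoprime f g)
    (D : Submodule k K) {α : F} (hα : α * aeval lam g = aeval lam f) :
    Module.finrank k ↥((boundedPoly l D).map (evalAt k lam) ⊓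
        shift k α ((boundedPoly l D).map (evalAt k lam))) =
      (l - m) * Module.finrank k K + Module.finrank k ↥(D.comap (LinearMap.mulLeft k (f.coeff m)) ⊓
        D.comap (LinearMap.mulLeft k (g.coeff m))) := by
  rw [shift_inf_eq_map hlam hl hm hf hg hf0 hmax hco D hα, finrank_map_of_injOn,
    finrank_boundedPoly]
  intro h hh h0
  rw [mem_boundedPoly] at hh
  have := hlam (f * h) ((natDegree_mul_le_of_le hf hh.1).trans_lt (by omega)) h0
  exact (mul_eq_zero.mp this).resolve_left hf0

lemma finrank_map_evalAt [FiniteDimensional k K] {lam : F} {t l : ℕ}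
    (hlam : NoSmallRoot K lam t) (hl : l < t) (D : Submodule k K) :
    Module.finrank k ((boundedPoly l D).map (evalAt k lam)) =
      l * Module.finrank k K + Module.finrank k D := by
  rw [finrank_map_of_injOn, finrank_boundedPoly]
  intro h hh h0
  exact hlam h ((mem_boundedPoly.mp hh).1.trans_lt hl) h0

lemma comap_mulLeft_inf_eq_bot {a b β : K} (hβ : β ∉ Submodule.span k {(1 : K)}) (hb : b ≠ 0)
    (hab : β * b = a) :
    (Submodule.span k {(1 : K)}).comap (LinearMap.mulLeft k a) ⊓
      (Submodule.span k {(1 : K)}).comap (LinearMap.mulLeft k b) = ⊥ := by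
  rw [eq_bot_iff]
  rintro x ⟨hx, hy⟩
  obtain ⟨c, hc⟩ := Submodule.mem_span_singleton.mp hx
  obtain ⟨d, hd⟩ := Submodule.mem_span_singleton.mp hy
  simp only [LinearMap.mulLeft_apply, Algebra.smul_def, mul_one] at hc hd
  by_cases h0 : d = 0
  · rw [h0, map_zero] at hd
    exact (mul_eq_zero.mp hd.symm).resolve_left hb
  · exfalso
    apply hβ
    rw [Submodule.mem_span_singleton]
    refine ⟨c / d, ?_⟩
    rw [Algebra.smul_def, mul_one, map_div₀, div_eq_iff (by simpa using h0), hc, hd, ← hab]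
    ring

lemma finrank_comap_mulLeft_le [FiniteDimensional k K] {a : K} (ha : a ≠ 0) :
    Module.finrank k ((Submodule.span k {(1 : K)}).comap (LinearMap.mulLeft k a)) ≤ 1 := by
  rw [← finrank_map_of_injOn (LinearMap.mulLeft k a) _
    fun x _ hx => (mul_eq_zero.mp hx).resolve_left ha]
  exact (Submodule.finrank_mono (Submodule.map_comap_le _ _)).trans
    (finrank_span_singleton one_ne_zero).le

lemma algebraMap_mem_span_one (x : k) :
    algebraMap k K x ∈ Submodule.span k {(1 : K)} := by
  rw [Submodule.mem_span_singleton]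
  exact ⟨x, (Algebra.algebraMap_eq_smul_one x).symm⟩

lemma ne_zero_of_notMem_span_one {β : K} (hβ : β ∉ Submodule.span k {(1 : K)}) : β ≠ 0 := by
  rintro rfl
  exact hβ (zero_mem _)

lemma finrank_inf_shift_of_notMem [FiniteDimensional k K] {lam : F} {t l : ℕ}
    (hlam : NoSmallRoot K lam t) (hl : 2 * l < t) {β : K}
    (hβ : β ∉ Submodule.span k {(1 : K)}) {S : Submodule k F}
    (hS : S = (boundedPoly l (Submodule.span k {(1 : K)})).map (evalAt k lam)) :
    Module.finrank k ↥(S ⊓ shift k (algebraMap K F β) S) = l * Module.finrank k K := by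
  have hβ0 := ne_zero_of_notMem_span_one hβ
  rw [hS, finrank_shift_inf (m := 0) (f := C β) (g := 1) hlam hl (Nat.zero_le l)
    (natDegree_C β).le natDegree_one.le (C_ne_zero.mpr hβ0) (Or.inl (by simpa using hβ0))
    isCoprime_one_right _ (by simp), comap_mulLeft_inf_eq_bot hβ (by simp) (by simp),
    finrank_bot, Nat.sub_zero, Nat.add_zero]

lemma finrank_inf_shift_pow [FiniteDimensional k K] {lam : F} {t l m : ℕ}
    (hlam : NoSmallRoot K lam t) (hl : 2 * l < t) (hm0 : 1 ≤ m) (hm : m ≤ l) {S : Submodule k F}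
    (hS : S = (boundedPoly l (Submodule.span k {(1 : K)})).map (evalAt k lam)) :
    Module.finrank k ↥(S ⊓ shift k (lam ^ m) S) = (l - m) * Module.finrank k K + 1 := by
  rw [hS, finrank_shift_inf (m := m) (f := X ^ m) (g := 1) hlam hl hm
    (natDegree_X_pow m).le (by simp) (pow_ne_zero _ X_ne_zero) (Or.inl (by simp))
    isCoprime_one_right _ (by simp)]
  have h0 : (1 : K[X]).coeff m = 0 := by
    rw [coeff_one, if_neg (by omega)]
  have h : (Submodule.span k {(1 : K)}).comap (LinearMap.mulLeft k ((X ^ m : K[X]).coeff m)) ⊓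
      (Submodule.span k {(1 : K)}).comap (LinearMap.mulLeft k ((1 : K[X]).coeff m)) =
      Submodule.span k {(1 : K)} := by
    ext x
    simp [h0]
  rw [h, finrank_span_singleton one_ne_zero]

lemma exists_finrank_inf_shift_eq [FiniteDimensional k K] {lam : F} {t l m : ℕ}
    (hlam : NoSmallRoot K lam t) (hl : 2 * l < t) (hm0 : 1 ≤ m) (hm : m ≤ l) {β : K}
    (hβ : β ∉ Submodule.span k {(1 : K)}) {S : Submodule k F}
    (hS : S = (boundedPoly l (Submodule.span k {(1 : K)})).map (evalAt k lam)) :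
    ∃ α : F, α ≠ 0 ∧
      Module.finrank k ↥(S ⊓ shift k α S) = (l - m) * Module.finrank k K := by
  have hβ0 := ne_zero_of_notMem_span_one hβ
  have hc : (C β * X ^ m + 1 : K[X]).coeff m = β := by
    rw [coeff_add, coeff_C_mul, coeff_X_pow_self, coeff_one, if_neg (by omega)]
    simp
  have hf0 : (C β * X ^ m + 1 : K[X]) ≠ 0 := by
    intro h
    rw [h, coeff_zero] at hc
    exact hβ0 hc.symm
  have hfd : (C β * X ^ m + 1 : K[X]).natDegree ≤ m :=
    natDegree_add_le_of_degree_le (natDegree_C_mul_X_pow_le β m) (by simp)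
  have hev : ∀ p : K[X], p.natDegree ≤ m → p ≠ 0 → aeval lam p ≠ 0 := fun p hp h0 h =>
    h0 (hlam p (by omega) h)
  have hX : aeval lam (X ^ m : K[X]) ≠ 0 :=
    hev _ (natDegree_X_pow m).le (pow_ne_zero _ X_ne_zero)
  refine ⟨aeval lam (C β * X ^ m + 1 : K[X]) / aeval lam (X ^ m : K[X]),
    div_ne_zero (hev _ hfd hf0) hX, ?_⟩
  rw [hS, finrank_shift_inf (m := m) (f := C β * X ^ m + 1) (g := X ^ m) hlam hl hm
    hfd (natDegree_X_pow m).le hf0 (Or.inr (by simp)) ⟨1, -C β, by ring⟩ _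
    (div_mul_cancel₀ _ hX), comap_mulLeft_inf_eq_bot hβ (by simp) (by simp [hc]),
    finrank_bot, Nat.add_zero]

lemma exists_eq_algebraMap_of_finrank_inf_shift [FiniteDimensional k K]
    (hK : Module.finrank k K = 2) {lam : F} {t l : ℕ} (hlam : NoSmallRoot K lam t)
    (hl : 2 * l < t) (hl0 : 1 ≤ l) {S : Submodule k F}
    (hS : S = (boundedPoly l (Submodule.span k {(1 : K)})).map (evalAt k lam)) {α : F}
    (hα : α ≠ 0) (hdim : Module.finrank k ↥(S ⊓ shift k α S) = l * 2) :
    ∃ β : K, β ∉ Submodule.span k {(1 : K)} ∧ algebraMap K F β = α := by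
  have hne : S ⊓ shift k α S ≠ ⊥ := by
    intro h
    rw [h, finrank_bot] at hdim
    omega
  obtain ⟨_, ⟨hx, hx'⟩, hx0⟩ := Submodule.exists_mem_ne_zero_of_ne_bot hne
  obtain ⟨y, hy, rfl⟩ := mem_shift.mp hx'
  have hy0 : y ≠ 0 := right_ne_zero_of_mul hx0
  rw [SetLike.mem_coe, hS] at hx
  rw [hS] at hy
  obtain ⟨p, hp, hpx⟩ := hx
  obtain ⟨r, hr, rfl⟩ := hy
  rw [SetLike.mem_coe, mem_boundedPoly] at hp hr
  rw [evalAt_apply] at hpx hy0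
  rw [evalAt_apply] at hpx
  have hp0 : p ≠ 0 := by
    rintro rfl
    exact hx0 (by rw [evalAt_apply, ← hpx, map_zero])
  have hr0 : r ≠ 0 := by
    rintro rfl
    simp at hy0
  obtain ⟨f, g, d, hrel, rfl, rfl⟩ := UniqueFactorizationMonoid.exists_reduced_factors p hp0 r
  have hd0 := left_ne_zero_of_mul hp0
  have hf0 := right_ne_zero_of_mul hp0
  have hg0 := right_ne_zero_of_mul hr0
  have hdeg := And.intro hp.1 hr.1
  rw [natDegree_mul hd0 hf0, natDegree_mul hd0 hg0] at hdeg
  have hfg : α * aeval lam g = aeval lam f := by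
    rw [map_mul] at hpx hy0
    rw [map_mul] at hpx
    apply mul_left_cancel₀ (left_ne_zero_of_mul hy0)
    rw [hpx]
    ring
  have hmax : f.coeff (max f.natDegree g.natDegree) ≠ 0 ∨
      g.coeff (max f.natDegree g.natDegree) ≠ 0 := by
    rcases max_choice f.natDegree g.natDegree with h | h <;> rw [h]
    · exact Or.inl (leadingCoeff_ne_zero.mpr hf0)
    · exact Or.inr (leadingCoeff_ne_zero.mpr hg0)
  have key := finrank_shift_inf (m := max f.natDegree g.natDegree) hlam hl (by omega)
    (le_max_left _ _) (le_max_right _ _) hf0 hmax hrel.isCoprime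
    (Submodule.span k {(1 : K)}) hfg
  rw [← hS, hdim, hK] at key
  have hle : Module.finrank k ↥((Submodule.span k {(1 : K)}).comap
      (LinearMap.mulLeft k (f.coeff (max f.natDegree g.natDegree))) ⊓
      (Submodule.span k {(1 : K)}).comap
      (LinearMap.mulLeft k (g.coeff (max f.natDegree g.natDegree)))) ≤ 1 := by
    rcases hmax with h | h
    · exact (Submodule.finrank_mono inf_le_left).trans (finrank_comap_mulLeft_le h)
    · exact (Submodule.finrank_mono inf_le_right).trans (finrank_comap_mulLeft_le h)
  have hm : max f.natDegree g.natDegree = 0 := by omega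
  obtain ⟨a, rfl⟩ := natDegree_eq_zero.mp (show f.natDegree = 0 by omega)
  obtain ⟨b, rfl⟩ := natDegree_eq_zero.mp (show g.natDegree = 0 by omega)
  have hb0 : b ≠ 0 := by simpa using hg0
  have hab : algebraMap K F (a / b) = α := by
    rw [map_div₀, div_eq_iff (by simpa using hb0)]
    simpa using hfg.symm
  refine ⟨a / b, fun hmem => ?_, hab⟩
  obtain ⟨c, hc⟩ := Submodule.mem_span_singleton.mp hmem
  have hcα : algebraMap k F c = α := by
    rw [← hab, ← hc, IsScalarTower.algebraMap_apply k K F, ← Algebra.algebraMap_eq_smul_one]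
  have hc0 : c ≠ 0 := by
    rintro rfl
    exact hα (by rw [← hcα, map_zero])
  rw [← hcα, shift_algebraMap hc0, inf_idem, hS, finrank_map_evalAt hlam (by omega), hK,
    finrank_span_singleton one_ne_zero] at hdim
  omega

lemma exists_notMem_span_one (hK : Module.finrank k K = 2) :
    ∃ ω : K, ω ∉ Submodule.span k {(1 : K)} := by
  by_contra! h
  have h1 : Submodule.span k {(1 : K)} = ⊤ := eq_top_iff.mpr fun x _ => h x
  have h2 := finrank_span_singleton (K := k) (one_ne_zero : (1 : K) ≠ 0)
  rw [h1, finrank_top] at h2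
  omega

lemma exists_eq_algebraMap_mul_add [FiniteDimensional k K] (hK : Module.finrank k K = 2)
    {ω β : K} (hω : ω ∉ Submodule.span k {(1 : K)})
    (hβ : β ∉ Submodule.span k {(1 : K)}) :
    ∃ c a : k, c ≠ 0 ∧ β = algebraMap k K c * (ω + algebraMap k K a) := by
  have hli : LinearIndependent k ![1, ω] := by
    rw [LinearIndependent.pair_iff' one_ne_zero]
    intro a ha
    exact hω (Submodule.mem_span_singleton.mpr ⟨a, ha⟩)
  have htop := hli.span_eq_top_of_card_eq_finrank' (by simp [hK])
  have hmem : β ∈ Submodule.span k (Set.range ![1, ω]) := htop ▸ Submodule.mem_top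
  rw [Matrix.range_cons, Matrix.range_cons, Matrix.range_empty, Set.union_empty,
    Set.singleton_union, Submodule.mem_span_pair] at hmem
  obtain ⟨x, y, hxy⟩ := hmem
  have hy : y ≠ 0 := by
    rintro rfl
    exact hβ (Submodule.mem_span_singleton.mpr ⟨x, by simpa using hxy⟩)
  have hy' : algebraMap k K y ≠ 0 := by simpa using hy
  refine ⟨y, x / y, hy, ?_⟩
  rw [← hxy, Algebra.smul_def, Algebra.smul_def, map_div₀]
  field_simp
  ring

lemma omega_one_eq_card [FiniteDimensional k K] (hK : Module.finrank k K = 2) {lam : F}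
    {t l : ℕ} (hlam : NoSmallRoot K lam t) (hl : 2 * l < t) (hl0 : 1 ≤ l) {S : Submodule k F}
    (hS : S = (boundedPoly l (Submodule.span k {(1 : K)})).map (evalAt k lam)) :
    omega k S 1 = Nat.card k := by
  obtain ⟨ω, hω⟩ := exists_notMem_span_one hK
  have hrank : Module.finrank k S = l * 2 + 1 := by
    rw [hS, finrank_map_evalAt hlam (by omega), hK, finrank_span_singleton one_ne_zero]
  have hωa (a : k) : ω + algebraMap k K a ∉ Submodule.span k {(1 : K)} := by
    rwa [Submodule.add_mem_iff_left _ (algebraMap_mem_span_one a)]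
  have hne {β : K} (hβ : β ∉ Submodule.span k {(1 : K)}) : algebraMap K F β ≠ 0 := by
    simpa using ne_zero_of_notMem_span_one hβ
  symm
  refine Nat.card_congr (Equiv.ofBijective
    (fun a => ⟨shift k (algebraMap K F (ω + algebraMap k K a)) S, ⟨_, hne (hωa a), rfl⟩, ?_⟩)
    ⟨?_, ?_⟩)
  · rw [sdist, finrank_shift (hne (hωa a)), hrank,
      finrank_inf_shift_of_notMem hlam hl (hωa a) hS, hK]
    omega
  · intro a b hab
    have hab' := congrArg Subtype.val hab
    simp only at hab'
    set x := ω + algebraMap k K a with hx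
    set y := ω + algebraMap k K b
    have hy0 := ne_zero_of_notMem_span_one (hωa b)
    have hfix : shift k (algebraMap K F (x / y)) S = S := by
      apply shift_injective (hne (hωa b))
      rw [← shift_mul, ← map_mul, mul_div_cancel₀ _ hy0, hab']
    have hmem : x / y ∈ Submodule.span k {(1 : K)} := by
      by_contra hnot
      have := finrank_inf_shift_of_notMem hlam hl hnot hS
      rw [hfix, inf_idem, hrank, hK] at this
      omega
    obtain ⟨c, hc⟩ := Submodule.mem_span_singleton.mp hmem
    rw [eq_div_iff hy0, ← Algebra.algebraMap_eq_smul_one] at hc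
    rw [hx] at hc
    by_cases h1 : c = 1
    · rw [h1, map_one, one_mul] at hc
      exact ((algebraMap k K).injective (add_left_cancel hc)).symm
    · exfalso
      apply hω
      have h2 : 1 - algebraMap k K c ≠ 0 := by
        rw [sub_ne_zero, ← map_one (algebraMap k K)]
        exact fun h => h1 ((algebraMap k K).injective h).symm
      have h3 : ω = algebraMap k K ((c * b - a) / (1 - c)) := by
        rw [map_div₀, map_sub, map_sub, map_mul, map_one, eq_div_iff h2]
        linear_combination -hc
      rw [h3]
      exact algebraMap_mem_span_one _
  · rintro ⟨_, ⟨α, hα, rfl⟩, hdist⟩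
    rw [sdist, finrank_shift hα, hrank] at hdist
    obtain ⟨β, hβ, rfl⟩ := exists_eq_algebraMap_of_finrank_inf_shift hK hlam hl hl0 hS hα
      (by omega)
    obtain ⟨c, a, hc, rfl⟩ := exists_eq_algebraMap_mul_add hK hω hβ
    refine ⟨a, Subtype.ext ?_⟩
    simp only
    rw [mul_comm, map_mul, shift_mul, ← IsScalarTower.algebraMap_apply, shift_algebraMap hc]

lemma isFWS_of_noSmallRoot [Finite F] [FiniteDimensional k K] (hK : Module.finrank k K = 2)
    {lam : F} {t l : ℕ} (hlam0 : lam ≠ 0) (hlam : NoSmallRoot K lam t) (hl : 2 * l < t)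
    {S : Submodule k F}
    (hS : S = (boundedPoly l (Submodule.span k {(1 : K)})).map (evalAt k lam)) : IsFWS k S := by
  obtain ⟨ω, hω⟩ := exists_notMem_span_one hK
  have hrank : Module.finrank k S = l * 2 + 1 := by
    rw [hS, finrank_map_evalAt hlam (by omega), hK, finrank_span_singleton one_ne_zero]
  intro i hi hi'
  rw [hrank] at hi'
  obtain ⟨m, rfl | rfl⟩ := Nat.even_or_odd' i
  · refine omega_pos (pow_ne_zero m hlam0) ?_
    rw [finrank_inf_shift_pow hlam hl (by omega) (by omega) hS, hrank, hK]
    omega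
  · rcases Nat.eq_zero_or_pos m with rfl | hm
    · refine omega_pos (α := algebraMap K F ω)
        (by simpa using ne_zero_of_notMem_span_one hω) ?_
      rw [finrank_inf_shift_of_notMem hlam hl hω hS, hrank, hK]
    · obtain ⟨α, hα, h⟩ := exists_finrank_inf_shift_eq hlam hl hm (by omega) hω hS
      refine omega_pos hα ?_
      rw [h, hrank, hK]
      omega

lemma mOrb_eq_of_forall_le [FiniteDimensional k F] {S : Submodule k F} (h1 : (1 : F) ∈ S)
    (L : IntermediateField k F) (hL : (S : Set F) ⊆ L)
    (hmin : ∀ T : IntermediateField k F, (S : Set F) ⊆ T → L ≤ T) :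
    mOrb k S = Module.finrank k L := by
  have hspan (T : IntermediateField k F) :
      Module.finrank T (Submodule.span T (S : Set F)) = 1 ↔ (S : Set F) ⊆ T := by
    have hle : Submodule.span T {(1 : F)} ≤ Submodule.span T (S : Set F) :=
      Submodule.span_mono (Set.singleton_subset_iff.mpr h1)
    have hr := finrank_span_singleton (K := T) (one_ne_zero : (1 : F) ≠ 0)
    have hmem (x : F) : x ∈ Submodule.span T {(1 : F)} ↔ x ∈ T := by
      rw [Submodule.mem_span_singleton]
      constructor
      · rintro ⟨c, rfl⟩
        rw [Algebra.smul_def, mul_one]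
        exact c.2
      · intro hx
        exact ⟨⟨x, hx⟩, by rw [Algebra.smul_def, mul_one]; rfl⟩
    constructor
    · intro h x hx
      have := Submodule.eq_of_le_of_finrank_eq hle (hr.trans h.symm)
      rw [SetLike.mem_coe, ← hmem, this]
      exact Submodule.subset_span hx
    · intro h
      rw [← hr, le_antisymm (Submodule.span_le.mpr fun x hx => (hmem x).mpr (h hx)) hle]
  apply le_antisymm
  · exact Nat.sInf_le ⟨Dvd.intro _ (Module.finrank_mul_finrank k L F), L, rfl, (hspan L).mpr hL⟩
  · refine le_csInf ⟨_, Dvd.intro _ (Module.finrank_mul_finrank k L F), L, rfl,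
      (hspan L).mpr hL⟩ ?_
    rintro _ ⟨-, T, rfl, hT⟩
    have hle : Subalgebra.toSubmodule L.toSubalgebra ≤ Subalgebra.toSubmodule T.toSubalgebra :=
      hmin T ((hspan T).mp hT)
    exact Submodule.finrank_mono hle

lemma noSmallRoot_finrank_adjoin [FiniteDimensional K F] (lam : F) :
    NoSmallRoot K lam (Module.finrank K (IntermediateField.adjoin K {lam})) := by
  intro p hp h0
  by_contra hne
  rw [IntermediateField.adjoin.finrank (Algebra.IsIntegral.isIntegral lam)] at hp
  exact hp.not_ge (natDegree_le_natDegree (minpoly.degree_le_of_ne_zero K lam hne h0))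

lemma mem_adjoin_of_mem_map_boundedPoly (lam : F) (l : ℕ) (D : Submodule k K) {x : F}
    (hx : x ∈ (boundedPoly l D).map (evalAt k lam)) :
    x ∈ IntermediateField.adjoin K {lam} := by
  obtain ⟨p, -, rfl⟩ := hx
  exact IntermediateField.algebra_adjoin_le_adjoin K _ (aeval_mem_adjoin_singleton K lam)

lemma two_mul_finrank_le_of_omega_pos [FiniteDimensional k F] {S : Submodule k F}
    (L : IntermediateField k F) (hS : (S : Set F) ⊆ L) (hS0 : 2 ≤ Module.finrank k S)
    (h : 0 < omega k S (Module.finrank k S - 1)) :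
    2 * Module.finrank k S ≤ Module.finrank k L + 1 := by
  obtain ⟨⟨_, ⟨α, hα, rfl⟩, hdist⟩⟩ := (Nat.card_pos_iff.mp h).1
  have hshift := finrank_shift hα S
  rw [sdist, hshift] at hdist
  have hinf : Module.finrank k ↥(S ⊓ shift k α S) = 1 := by omega
  have hne : S ⊓ shift k α S ≠ ⊥ := by
    intro h
    rw [h, finrank_bot] at hinf
    omega
  obtain ⟨_, ⟨hx, hx'⟩, hx0⟩ := Submodule.exists_mem_ne_zero_of_ne_bot hne
  obtain ⟨y, hy, rfl⟩ := mem_shift.mp hx'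
  have hαL : α ∈ L := by
    have := L.div_mem (hS hx) (hS hy)
    rwa [mul_div_cancel_right₀ _ (right_ne_zero_of_mul hx0)] at this
  have hle : S ⊔ shift k α S ≤ Subalgebra.toSubmodule L.toSubalgebra := by
    refine sup_le (fun x hx => hS hx) ?_
    rintro _ ⟨s, hs, rfl⟩
    exact L.mul_mem hαL (hS hs)
  have h1 : Module.finrank k ↥(S ⊔ shift k α S) ≤ Module.finrank k L :=
    Submodule.finrank_mono hle
  have h2 := Submodule.finrank_sup_add_finrank_inf_eq S (shift k α S)
  omega

end General

end FWS

open FWS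

/-- Corollary 4.9: for `n` even, `λ ∈ F_{q^n} \ F_{q^2}`,
`t = [F_{q^2}(λ):F_{q^2}]` and `S = ⟨1, λ, …, λ^(l-1)⟩_{F_{q^2}} ⊕ λ^l F_q`,
the code `Orb(S)` is an FWS code in `G_q(n, 2l+1)` with `m = 2t` iff `2l+1 ≤ t`;
and in that case `ω_2 = q`. -/
theorem family2_is_FWS_iff
    {Fq F : Type*} [Field Fq] [Field F] [Algebra Fq F] [Fintype Fq] [Fintype F]
    (q n : ℕ) (hq : Fintype.card Fq = q) (hn : Module.finrank Fq F = n) (hneven : Even n)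
    (T2 : IntermediateField Fq F) (hT2 : Module.finrank Fq ↥T2 = 2)
    (lam : F) (hlam : lam ∉ T2)
    (t : ℕ) (ht : Module.finrank ↥T2 ↥(IntermediateField.adjoin ↥T2 {lam}) = t)
    (l : ℕ) (hl : 1 ≤ l)
    (S : Submodule Fq F)
    (hS : S = (polySpan ↥T2 lam l).restrictScalars Fq ⊔ Submodule.span Fq {lam ^ l}) :
    ((IsFWS Fq S ∧ Module.finrank Fq ↥S = 2 * l + 1 ∧ mOrb Fq S = 2 * t) ↔ 2 * l + 1 ≤ t) ∧
    (2 * l + 1 ≤ t → omega Fq S 1 = q) := by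
  have hkF : FiniteDimensional Fq F := Module.Finite.of_finite
  have hS' := hS.trans (polySpan_sup_eq_map lam l)
  have hlam0 : lam ≠ 0 := by
    rintro rfl
    exact hlam T2.zero_mem
  have hroot : NoSmallRoot T2 lam t := ht ▸ noSmallRoot_finrank_adjoin lam
  set L := (IntermediateField.adjoin T2 {lam}).restrictScalars Fq with hL
  have hLt : Module.finrank Fq L = 2 * t := by
    rw [← ht, ← hT2]
    exact (Module.finrank_mul_finrank Fq T2 (IntermediateField.adjoin T2 {lam})).symm
  have hSL : (S : Set F) ⊆ L := by
    intro x hx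
    rw [hS'] at hx
    exact mem_adjoin_of_mem_map_boundedPoly lam l _ hx
  have hTS {x : F} (hx : x ∈ T2) : x ∈ S := by
    rw [hS]
    refine Submodule.mem_sup_left ?_
    have h1 : (1 : F) ∈ polySpan T2 lam l := Submodule.subset_span ⟨0, hl, pow_zero lam⟩
    have := (polySpan T2 lam l).smul_mem ⟨x, hx⟩ h1
    rw [Algebra.smul_def, mul_one] at this
    exact this
  have hlamS : lam ∈ S := by
    rw [hS]
    rcases hl.eq_or_lt with rfl | h
    · refine Submodule.mem_sup_right ?_
      rw [pow_one]
      exact Submodule.mem_span_singleton_self lam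
    · exact Submodule.mem_sup_left (Submodule.subset_span ⟨1, h, pow_one lam⟩)
  have hm : mOrb Fq S = 2 * t := by
    rw [← hLt]
    refine mOrb_eq_of_forall_le (hTS T2.one_mem) L hSL fun T hT => ?_
    have hle : T2 ≤ T := fun x hx => hT (hTS hx)
    have hadj : IntermediateField.adjoin T2 {lam} ≤ IntermediateField.extendScalars hle :=
      IntermediateField.adjoin_le_iff.mpr (Set.singleton_subset_iff.mpr (hT hlamS))
    exact fun x hx => hadj hx
  refine ⟨⟨?_, ?_⟩, ?_⟩
  · rintro ⟨hfws, hdim, -⟩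
    have := two_mul_finrank_le_of_omega_pos L hSL (by omega) (hfws _ (by omega) (by omega))
    omega
  · intro hlt
    refine ⟨isFWS_of_noSmallRoot hT2 hlam0 hroot hlt hS', ?_, hm⟩
    rw [hS', finrank_map_evalAt hroot (by omega), hT2, finrank_span_singleton one_ne_zero,
      mul_comm]
  · intro hlt
    rw [omega_one_eq_card hT2 hroot hlt hl hS', Nat.card_eq_fintype_card, hq]
end

section
/- Let F_{q^t} = F_q(λ) be a subfield of F_{q^n}, let S̄ be an F_{q^t}-subspace of F_{q^n} with dim_{F_{q^t}}(S̄) = l and S̄ ∩ b·F_{q^t} = {0} for some b ∈ F_{q^n}^*, let 0 < m < t, let S = S̄ ⊕ b·⟨1, λ, …, λ^{m−1}⟩_{F_q} ∈ G_q(n,k) with k = tl + m, let Y = S̄ ⊕ b·F_{q^t}, and let C = Orb(S). If m < t − 1 and H(Y) = F_{q^t}, then ω_{2m+2}(C) = 0. -/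
/-!
Setting: `q` is a prime power, realized by a finite field `Fq` with `Fintype.card Fq = q`;
`F` plays the role of `F_{q^n}`: a finite field extension of `Fq` with `Module.finrank Fq F = n`.
`F_q`-subspaces of `F_{q^n}` are `Submodule Fq F`; for a divisor `t` of `n`, the subfield
`F_{q^t}` is the (unique) `T : IntermediateField Fq F` with `Module.finrank Fq ↥T = t`, and
`F_{q^t}`-subspaces are `Submodule ↥T F`.
-/

set_option synthInstance.maxHeartbeats 1000000

open FWS

namespace FWS

variable {K F : Type*} [Field K] [Field F] [Algebra K F]

theorem finrank_map_mulLeft {α : F} (hα : α ≠ 0) (S : Submodule K F) :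
    Module.finrank K (S.map (LinearMap.mulLeft K α)) = Module.finrank K S :=
  (Submodule.equivMapOfInjective _ (mul_right_injective₀ hα) S).finrank_eq.symm

theorem finrank_restrictScalars (T : IntermediateField K F) (Z : Submodule T F) :
    Module.finrank K (Z.restrictScalars K) = Module.finrank K T * Module.finrank T Z :=
  (Module.finrank_mul_finrank K T Z).symm

theorem polySpan_le (T : IntermediateField K F) {x : F} (hx : x ∈ T) (m : ℕ) :
    polySpan K x m ≤ Subalgebra.toSubmodule T.toSubalgebra :=
  Submodule.span_le.2 (by rintro _ ⟨i, -, rfl⟩; exact pow_mem hx i)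

/-- If a subspace of codimension at most one in the `T`-subspace `Z` lies in `S`, where `S`
contains the `T`-subspace `V` with codimension less than `[T : K] - 1`, then `Z ≤ V`. -/
theorem le_of_finrank_le_finrank_add_one [FiniteDimensional K F]
    (T : IntermediateField K F) {Z V : Submodule T F} {S W : Submodule K F}
    (hVS : V.restrictScalars K ≤ S) (hWS : W ≤ S)
    (hWZ : W ≤ Z.restrictScalars K)
    (hW : Module.finrank K (Z.restrictScalars K) ≤ Module.finrank K W + 1)
    (hS : Module.finrank K S + 1 < Module.finrank K (V.restrictScalars K) + Module.finrank K T) :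
    Z ≤ V := by
  intro z hz
  by_contra hzV
  have hz0 : z ≠ 0 := fun h => hzV (h ▸ V.zero_mem)
  set L : Submodule K F := (Submodule.span T {z}).restrictScalars K with hL
  have hLrank : Module.finrank K L = Module.finrank K T := by
    rw [hL, finrank_restrictScalars, finrank_span_singleton hz0, mul_one]
  have hLZ : L ≤ Z.restrictScalars K := by
    intro x hx
    exact (Submodule.span_singleton_le_iff_mem z Z).2 hz hx
  have hdisj : (W ⊓ L) ⊓ V.restrictScalars K = ⊥ := by
    rw [eq_bot_iff]
    rintro x ⟨⟨-, hxL⟩, hxV⟩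
    obtain ⟨c, rfl⟩ := Submodule.mem_span_singleton.1 hxL
    by_cases hc : c = 0
    · simp [hc]
    · exact absurd ((V.smul_mem_iff hc).1 hxV) hzV
  have h₁ := Submodule.finrank_sup_add_finrank_inf_eq W L
  have h₂ := Submodule.finrank_mono (sup_le hWZ hLZ)
  have h₃ := Submodule.finrank_sup_add_finrank_inf_eq (W ⊓ L) (V.restrictScalars K)
  have h₄ := Submodule.finrank_mono (sup_le (inf_le_left.trans hWS : W ⊓ L ≤ S) hVS)
  rw [hdisj, finrank_bot] at h₃
  omega

end FWS


/-- Theorem 6.4(i): for `S = S̄ ⊕ b⟨1, λ, …, λ^(m-1)⟩_{F_q}` with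
`Y = S̄ ⊕ b F_{q^t}`, if `m < t - 1` and `H(Y) = F_{q^t}`, then `ω_{2m+2}(Orb(S)) = 0`. -/
theorem omega_2m_plus_2_eq_zero
    {Fq F : Type*} [Field Fq] [Field F] [Algebra Fq F] [Fintype Fq] [Fintype F]
    (q n t : ℕ) (hq : Fintype.card Fq = q) (hn : Module.finrank Fq F = n)
    (lam : F) (hlam : lam ∉ Set.range (algebraMap Fq F))
    (T : IntermediateField Fq F) (hTlam : IntermediateField.adjoin Fq {lam} = T)
    (hT : Module.finrank Fq ↥T = t)
    (Sbar : Submodule ↥T F) (l : ℕ) (hSbar : Module.finrank ↥T ↥Sbar = l)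
    (b : F) (hb : b ≠ 0) (hbS : Submodule.span ↥T {b} ⊓ Sbar = ⊥)
    (m k : ℕ) (hm0 : 0 < m) (hmt : m < t) (hk : k = t * l + m)
    (S : Submodule Fq F)
    (hS : S = Sbar.restrictScalars Fq ⊔ shift Fq b (polySpan Fq lam m))
    (hSk : Module.finrank Fq ↥S = k)
    (Y : Submodule ↥T F) (hY : Y = Sbar ⊔ Submodule.span ↥T {b})
    (hmt1 : m < t - 1) (hHY : stab (Y : Set F) = (T : Set F)) :
    omega Fq S (m + 1) = 0 := by
  have hlamT : lam ∈ T := hTlam ▸ IntermediateField.mem_adjoin_simple_self Fq lam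
  have hSbarS : Sbar.restrictScalars Fq ≤ S := hS ▸ le_sup_left
  have hSY : S ≤ Y.restrictScalars Fq := by
    rw [hS, hY]
    refine sup_le (fun x hx => Submodule.mem_sup_left hx) ?_
    rintro _ ⟨p, hp, rfl⟩
    refine Submodule.mem_sup_right (Submodule.mem_span_singleton.2
      ⟨⟨p, polySpan_le T hlamT m hp⟩, ?_⟩)
    exact mul_comm p b
  have hYrank : Module.finrank T Y ≤ l + 1 := by
    rw [hY, ← hSbar, ← finrank_span_singleton (K := T) hb]
    exact Submodule.finrank_add_le_finrank_add_finrank _ _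
  have hSbarK : Module.finrank Fq (Sbar.restrictScalars Fq) = t * l := by
    rw [finrank_restrictScalars, hT, hSbar]
  rw [omega, Nat.card_eq_zero]
  refine Or.inl ⟨?_⟩
  rintro ⟨_, ⟨α, hα, rfl⟩, hd⟩
  have hshift : Module.finrank Fq (shift Fq α S) = Module.finrank Fq S :=
    finrank_map_mulLeft hα S
  rw [sdist, hshift, hSk] at hd
  have hW : Module.finrank Fq ↥(S ⊓ shift Fq α S) + 1 = t * l := by omega
  have hnot : ¬ (Sbar.restrictScalars Fq ≤ shift Fq α S) := by
    intro h
    have := Submodule.finrank_mono (le_inf hSbarS h)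
    omega
  set αY : Submodule T F := Y.map (LinearMap.mulLeft T α) with hαY
  set αSbar : Submodule T F := Sbar.map (LinearMap.mulLeft T α) with hαSbar
  have hαYrank : Module.finrank T αY = Module.finrank T Y := finrank_map_mulLeft hα Y
  have hαSbarrank : Module.finrank T αSbar = l :=
    (finrank_map_mulLeft hα Sbar).trans hSbar
  have hαSbarS : αSbar.restrictScalars Fq ≤ shift Fq α S := by
    rintro _ ⟨s, hs, rfl⟩
    exact ⟨s, hSbarS hs, rfl⟩
  have hαT : α ∉ T := by
    intro hαT
    refine hnot fun s hs => ⟨α⁻¹ * s, hSbarS ?_, mul_inv_cancel_left₀ hα s⟩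
    exact Sbar.smul_mem (⟨α⁻¹, inv_mem hαT⟩ : T) hs
  have hne : αY ≠ Y := by
    intro h
    have hmem : α ∈ stab (Y : Set F) :=
      Or.inl ⟨hα, congrArg (fun V : Submodule T F => (V : Set F)) h⟩
    rw [hHY] at hmem
    exact hαT hmem
  set Z : Submodule T F := Y ⊓ αY with hZ
  have hZY : Module.finrank T Z < Module.finrank T Y := by
    refine Submodule.finrank_lt_finrank_of_lt (lt_of_le_of_ne inf_le_left fun h => hne ?_)
    exact (Submodule.eq_of_le_of_finrank_eq (inf_eq_left.1 h) hαYrank.symm).symm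
  have hWZ : S ⊓ shift Fq α S ≤ Z.restrictScalars Fq := by
    rintro x ⟨hx, s, hs, rfl⟩
    exact ⟨hSY hx, s, hSY hs, rfl⟩
  have hZK : Module.finrank Fq (Z.restrictScalars Fq) = t * Module.finrank T Z := by
    rw [finrank_restrictScalars, hT]
  have hZrank : Module.finrank T Z = l := by
    have hle := Submodule.finrank_mono hWZ
    rw [hZK] at hle
    by_contra hlt
    have := Nat.mul_le_mul_left t (show Module.finrank T Z + 1 ≤ l by omega)
    rw [mul_add] at this
    omega
  rw [hZrank] at hZK
  have hZSbar : Z = Sbar := by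
    refine Submodule.eq_of_le_of_finrank_eq ?_ (hZrank.trans hSbar.symm)
    exact le_of_finrank_le_finrank_add_one T hSbarS inf_le_left hWZ (by omega) (by omega)
  have hZαSbar : Z ≤ αSbar := by
    have hαSbarK : Module.finrank Fq (αSbar.restrictScalars Fq) = t * l := by
      rw [finrank_restrictScalars, hT, hαSbarrank]
    exact le_of_finrank_le_finrank_add_one T hαSbarS inf_le_right hWZ (by omega) (by omega)
  exact hnot fun s hs => hαSbarS (hZαSbar (hZSbar ▸ hs))
end
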